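/- For every p ∈ (0,1) there exists n_0 (one may take n_0 = ⌈4.44·ω(p) + 7⌉ with ω(p) = (2p−1)²/(p(1−p))) such that for all n ≥ n_0, H[B(n+1,p)] − H[B(n,p)] ≥ (1/2)·log((n+1)/n). -/

import Mathlib

open Real

noncomputable def binEnt (p : ℝ) : ℝ := -(p * Real.log p) - (1 - p) * Real.log (1 - p)

noncomputable def binomPmf (n : ℕ) (p : ℝ) (k : ℕ) : ℝ :=
  (n.choose k : ℝ) * p ^ k * (1 - p) ^ (n - k)

noncomputable def binomEnt (n : ℕ) (p : ℝ) : ℝ :=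
  -∑ k ∈ Finset.range (n + 1), binomPmf n p k * Real.log (binomPmf n p k)

/-! ### Binomial expectations -/

lemma bp_succ_zero (n : ℕ) (p : ℝ) : binomPmf (n+1) p 0 = (1-p) * binomPmf n p 0 := by
  simp [binomPmf, pow_succ]; ring

lemma bp_succ_succ (n : ℕ) (p : ℝ) (k : ℕ) :
    binomPmf (n+1) p (k+1) = p * binomPmf n p k + (1-p) * binomPmf n p (k+1) := by
  unfold binomPmf
  rw [Nat.choose_succ_succ]
  rcases lt_or_ge n (k+1) with h | h
  · rw [Nat.choose_eq_zero_of_lt h]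
    have : n + 1 - (k+1) = n - k := by omega
    rw [this]; push_cast; ring
  · have h1 : n + 1 - (k+1) = n - k := by omega
    have h2 : n - k = (n - (k+1)) + 1 := by omega
    rw [h1, h2]; push_cast; ring

lemma bp_top (n : ℕ) (p : ℝ) : binomPmf n p (n+1) = 0 := by
  simp [binomPmf]

/-- expectation under the binomial law -/
noncomputable def bE (n : ℕ) (p : ℝ) (f : ℕ → ℝ) : ℝ :=
  ∑ k ∈ Finset.range (n+1), binomPmf n p k * f k

lemma bE_succ (n : ℕ) (p : ℝ) (f : ℕ → ℝ) :
    bE (n+1) p f = p * bE n p (fun k => f (k+1)) + (1-p) * bE n p f := by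
  unfold bE
  rw [Finset.sum_range_succ']
  simp_rw [bp_succ_succ, bp_succ_zero]
  have h : ∑ k ∈ Finset.range (n+1), binomPmf n p k * f k
      = ∑ k ∈ Finset.range (n+1), binomPmf n p (k+1) * f (k+1) + binomPmf n p 0 * f 0 := by
    rw [← Finset.sum_range_succ' (fun k => binomPmf n p k * f k), Finset.sum_range_succ _ (n+1), bp_top]
    simp
  rw [h, mul_add, Finset.mul_sum, Finset.mul_sum, ← add_assoc, ← Finset.sum_add_distrib]
  congr 1
  · apply Finset.sum_congr rfl
    intros; ring
  · ring

/-- central moments -/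
noncomputable def cm (n : ℕ) (p : ℝ) (j : ℕ) : ℝ := bE n p (fun k => ((k:ℝ) - n * p)^j)

lemma cm_shift (n : ℕ) (p a : ℝ) (j : ℕ) :
    bE n p (fun k => ((k:ℝ) - n * p + a)^j)
      = ∑ m ∈ Finset.range (j+1), cm n p m * a^(j-m) * (j.choose m) := by
  unfold cm bE
  simp_rw [add_pow, Finset.mul_sum, Finset.sum_mul]
  rw [Finset.sum_comm]
  apply Finset.sum_congr rfl; intro m _
  apply Finset.sum_congr rfl; intros; ring

lemma cm_succ (n : ℕ) (p : ℝ) (j : ℕ) :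
    cm (n+1) p j = ∑ m ∈ Finset.range (j+1),
      cm n p m * (p * (1-p)^(j-m) + (1-p) * (-p)^(j-m)) * (j.choose m) := by
  unfold cm
  rw [bE_succ]
  have h1 : (fun k : ℕ => (((k+1 : ℕ):ℝ) - ((n+1:ℕ):ℝ) * p)^j)
      = fun k : ℕ => ((k:ℝ) - n * p + (1-p))^j := by
    funext k; push_cast; congr 1; ring
  have h2 : (fun k : ℕ => ((k:ℝ) - ((n+1:ℕ):ℝ) * p)^j)
      = fun k : ℕ => ((k:ℝ) - n * p + (-p))^j := by
    funext k; push_cast; congr 1; ring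
  rw [h1, h2, cm_shift, cm_shift, Finset.mul_sum, Finset.mul_sum, ← Finset.sum_add_distrib]
  apply Finset.sum_congr rfl; intros; unfold cm; ring

lemma cm_zero (p : ℝ) (j : ℕ) : cm 0 p j = 0 ^ j := by
  simp [cm, bE, binomPmf]

lemma cm_all (n : ℕ) (p : ℝ) : cm n p 0 = 1 ∧ cm n p 1 = 0 ∧
    cm n p 2 = n * (p*(1-p)) ∧
    cm n p 3 = (1-2*p) * (n * (p*(1-p))) ∧
    cm n p 4 = n * (p*(1-p)) - 6 * n * (p*(1-p))^2 + 3 * n^2 * (p*(1-p))^2 ∧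
    cm n p 5 = (1-2*p) * (n * (p*(1-p)) - 12 * n * (p*(1-p))^2 + 10 * n^2 * (p*(1-p))^2) ∧
    cm n p 6 = n * (p*(1-p)) - 30 * n * (p*(1-p))^2 + 120 * n * (p*(1-p))^3
      + 25 * n^2 * (p*(1-p))^2 - 130 * n^2 * (p*(1-p))^3 + 15 * n^3 * (p*(1-p))^3 ∧
    cm n p 7 = (1-2*p) * (n * (p*(1-p)) - 60 * n * (p*(1-p))^2 + 360 * n * (p*(1-p))^3
      + 56 * n^2 * (p*(1-p))^2 - 462 * n^2 * (p*(1-p))^3 + 105 * n^3 * (p*(1-p))^3) := by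
  induction n with
  | zero => simp [cm_zero]
  | succ n ih =>
    obtain ⟨h0, h1, h2, h3, h4, h5, h6, h7⟩ := ih
    refine ⟨?_, ?_, ?_, ?_, ?_, ?_, ?_, ?_⟩ <;>
    · rw [cm_succ]
      simp [Finset.sum_range_succ, h0, h1, h2, h3, h4, h5, h6, h7, Nat.choose]
      try ring

/-! ### Entropy increment as an expected relative entropy -/

noncomputable def kl (p x : ℝ) : ℝ := x * Real.log (x / p) + (1-x) * Real.log ((1-x)/(1-p))

lemma bp_pos {n k : ℕ} {p : ℝ} (hp : 0 < p) (hp1 : p < 1) (hk : k ≤ n) : 0 < binomPmf n p k := by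
  unfold binomPmf
  have : 0 < (n.choose k : ℝ) := by exact_mod_cast Nat.choose_pos hk
  have : 0 < 1 - p := by linarith
  positivity

lemma bp_up (n k : ℕ) (p : ℝ) (hk : k ≤ n) :
    binomPmf (n+1) p (k+1) * ((k:ℝ)+1) / ((n:ℝ)+1) = p * binomPmf n p k := by
  unfold binomPmf
  have h1 : n + 1 - (k+1) = n - k := by omega
  have h : ((n:ℝ)+1) * (n.choose k) = ((n+1).choose (k+1)) * ((k:ℝ)+1) := by
    exact_mod_cast Nat.add_one_mul_choose_eq n k
  rw [h1, div_eq_iff (by positivity)]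
  linear_combination (-(p^(k+1) * (1-p)^(n-k))) * h

lemma bp_same (n k : ℕ) (p : ℝ) (hk : k ≤ n) :
    binomPmf (n+1) p k * (1 - (k:ℝ) / ((n:ℝ)+1)) = (1-p) * binomPmf n p k := by
  unfold binomPmf
  have h1 : n + 1 - k = (n - k) + 1 := by omega
  have h : ((n:ℝ)+1) * (n.choose k) = ((n+1).choose k) * ((n:ℝ)+1 - k) := by
    have := Nat.choose_mul_succ_eq n k
    have h2 : (((n + 1 - k : ℕ)):ℝ) = (n:ℝ)+1-k := by
      rw [Nat.cast_sub (by omega)]; push_cast; ring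
    rw [← h2]
    rw [mul_comm]
    exact_mod_cast this
  have hn : (n:ℝ)+1 ≠ 0 := by positivity
  rw [h1]
  field_simp
  linear_combination (-(p^k * (1-p)^(n-k+1))) * h

lemma ent_diff (n : ℕ) (p : ℝ) (hp : 0 < p) (hp1 : p < 1) :
    binomEnt (n+1) p - binomEnt n p = bE (n+1) p (fun k => kl p ((k:ℝ)/((n:ℝ)+1))) := by
  have hn : (0:ℝ) < (n:ℝ)+1 := by positivity
  have hq : 0 < 1 - p := by linarith
  have e1 : ∑ k ∈ Finset.range (n+1), p * (binomPmf n p k * Real.log (binomPmf n p k))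
      = ∑ k ∈ Finset.range (n+1+1), binomPmf (n+1) p k * ((k:ℝ)/((n:ℝ)+1)) *
          (Real.log (binomPmf (n+1) p k) + Real.log ((k:ℝ)/((n:ℝ)+1)/p)) := by
    rw [Finset.sum_range_succ' _ (n+1)]
    rw [show ((0:ℕ):ℝ)/((n:ℝ)+1) = 0 by simp]
    simp only [mul_zero, zero_mul, add_zero]
    apply Finset.sum_congr rfl
    intro k hk
    have hk : k ≤ n := by simpa [Nat.lt_succ_iff] using hk
    have hb := bp_up n k p hk
    have hpos := bp_pos hp hp1 (Nat.succ_le_succ hk)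
    have hx : (0:ℝ) < ((k:ℝ)+1)/((n:ℝ)+1) := by positivity
    push_cast
    rw [← Real.log_mul hpos.ne' (by positivity)]
    have : binomPmf n p k = binomPmf (n+1) p (k+1) * (((k:ℝ)+1)/((n:ℝ)+1)/p) := by
      field_simp; field_simp at hb; linarith
    rw [← this]
    linear_combination (-Real.log (binomPmf n p k)) * hb
  have e2 : ∑ k ∈ Finset.range (n+1), (1-p) * (binomPmf n p k * Real.log (binomPmf n p k))
      = ∑ k ∈ Finset.range (n+1+1), binomPmf (n+1) p k * (1-(k:ℝ)/((n:ℝ)+1)) *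
          (Real.log (binomPmf (n+1) p k) + Real.log ((1-(k:ℝ)/((n:ℝ)+1))/(1-p))) := by
    rw [Finset.sum_range_succ _ (n+1)]
    have h0 : 1 - ((n+1:ℕ):ℝ)/((n:ℝ)+1) = 0 := by
      push_cast; field_simp; ring
    rw [h0]
    simp only [mul_zero, zero_mul, add_zero]
    apply Finset.sum_congr rfl
    intro k hk
    have hk : k ≤ n := by simpa [Nat.lt_succ_iff] using hk
    have hb := bp_same n k p hk
    have hpos := bp_pos hp hp1 (Nat.le_succ_of_le hk)
    have hx : (0:ℝ) < 1 - (k:ℝ)/((n:ℝ)+1) := by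
      have : (k:ℝ) ≤ n := by exact_mod_cast hk
      rw [sub_pos, div_lt_one hn]; linarith
    rw [← Real.log_mul hpos.ne' (by positivity)]
    have : binomPmf n p k = binomPmf (n+1) p k * ((1-(k:ℝ)/((n:ℝ)+1))/(1-p)) := by
      rw [← mul_div_assoc, hb]; field_simp
    rw [← this]
    linear_combination (-Real.log (binomPmf n p k)) * hb
  have e3 : ∑ k ∈ Finset.range (n+1), binomPmf n p k * Real.log (binomPmf n p k)
     = ∑ k ∈ Finset.range (n+1), p * (binomPmf n p k * Real.log (binomPmf n p k))
      + ∑ k ∈ Finset.range (n+1), (1-p) * (binomPmf n p k * Real.log (binomPmf n p k)) := by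
    rw [← Finset.sum_add_distrib]
    apply Finset.sum_congr rfl; intros; ring
  unfold binomEnt bE kl
  rw [e3, e1, e2, ← Finset.sum_add_distrib, neg_sub_neg, ← Finset.sum_sub_distrib]
  apply Finset.sum_congr rfl; intros; ring

/-! ### Polynomial minorant of the relative entropy -/

noncomputable def P7 (u : ℝ) : ℝ :=
  u + u^2/2 - u^3/6 + u^4/12 - u^5/20 + u^6/30 - u^7/42

noncomputable def Q6 (u : ℝ) : ℝ :=
  u - u^2/2 + u^3/3 - u^4/4 + u^5/5 - u^6/6

lemma hasDeriv_Q6 (u : ℝ) : HasDerivAt Q6 (1 - u + u^2 - u^3 + u^4 - u^5) u := by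
  unfold Q6
  have h := hasDerivAt_id' u
  refine (((((h.sub ((h.pow 2).div_const 2)).add ((h.pow 3).div_const 3)).sub
    ((h.pow 4).div_const 4)).add ((h.pow 5).div_const 5)).sub
    ((h.pow 6).div_const 6)).congr_deriv ?_
  norm_num

lemma hasDeriv_P7 (u : ℝ) : HasDerivAt P7 (1 + Q6 u) u := by
  unfold P7 Q6
  have h := hasDerivAt_id' u
  refine ((((((h.add ((h.pow 2).div_const 2)).sub ((h.pow 3).div_const 6)).add
    ((h.pow 4).div_const 12)).sub ((h.pow 5).div_const 20)).add ((h.pow 6).div_const 30)).sub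
    ((h.pow 7).div_const 42)).congr_deriv ?_
  norm_num; ring

noncomputable def G1 (u : ℝ) : ℝ := Real.log (1+u) - Q6 u
noncomputable def G0 (u : ℝ) : ℝ := (1+u) * Real.log (1+u) - P7 u

lemma hasDeriv_log1 {u : ℝ} (hu : -1 < u) :
    HasDerivAt (fun u : ℝ => Real.log (1+u)) (1/(1+u)) u :=
  ((hasDerivAt_id' u).const_add 1).log (by linarith)

lemma hasDeriv_G1 {u : ℝ} (hu : -1 < u) : HasDerivAt G1 (u^6/(1+u)) u := by
  have h1 : (1+u) ≠ 0 := by linarith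
  refine ((hasDeriv_log1 hu).sub (hasDeriv_Q6 u)).congr_deriv ?_
  field_simp; ring

lemma hasDeriv_G0 {u : ℝ} (hu : -1 < u) : HasDerivAt G0 (G1 u) u := by
  have h1 : (1+u) ≠ 0 := by linarith
  refine ((((hasDerivAt_id' u).const_add 1).mul (hasDeriv_log1 hu)).sub (hasDeriv_P7 u)).congr_deriv ?_
  unfold G1
  field_simp; ring

lemma G1_mono : MonotoneOn G1 (Set.Ioi (-1)) := by
  apply monotoneOn_of_deriv_nonneg (convex_Ioi _)
  · exact fun u hu => (hasDeriv_G1 hu).continuousAt.continuousWithinAt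
  · rw [interior_Ioi]
    exact fun u hu => (hasDeriv_G1 hu).differentiableAt.differentiableWithinAt
  · rw [interior_Ioi]
    intro u hu
    rw [(hasDeriv_G1 hu).deriv]
    have : 0 < 1 + u := by have := Set.mem_Ioi.1 hu; linarith
    positivity

lemma G1_zero : G1 0 = 0 := by simp [G1, Q6]
lemma G0_zero : G0 0 = 0 := by simp [G0, P7]

lemma G0_nonneg {u : ℝ} (hu : -1 < u) : 0 ≤ G0 u := by
  rcases le_total 0 u with h | h
  · have : MonotoneOn G0 (Set.Ici 0) := by
      apply monotoneOn_of_deriv_nonneg (convex_Ici _)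
      · exact fun u hu => (hasDeriv_G0 (by have := Set.mem_Ici.1 hu; linarith)).continuousAt.continuousWithinAt
      · rw [interior_Ici]
        exact fun u hu => (hasDeriv_G0 (by have := Set.mem_Ioi.1 hu; linarith)).differentiableAt.differentiableWithinAt
      · rw [interior_Ici]
        intro u hu
        have hu := Set.mem_Ioi.1 hu
        rw [(hasDeriv_G0 (by linarith)).deriv, ← G1_zero]
        exact G1_mono (by simp) (by simp; linarith) hu.le
    rw [← G0_zero]
    exact this (by simp) h h
  · have : AntitoneOn G0 (Set.Ioc (-1) 0) := by
      apply antitoneOn_of_deriv_nonpos (convex_Ioc _ _)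
      · exact fun u hu => (hasDeriv_G0 hu.1).continuousAt.continuousWithinAt
      · rw [interior_Ioc]
        exact fun u hu => (hasDeriv_G0 hu.1).differentiableAt.differentiableWithinAt
      · rw [interior_Ioc]
        intro u hu
        rw [(hasDeriv_G0 hu.1).deriv, ← G1_zero]
        exact G1_mono hu.1 (by simp) hu.2.le
    rw [← G0_zero]
    exact this ⟨hu, h⟩ (by simp) h

lemma P7_le {u : ℝ} (hu : -1 ≤ u) : P7 u ≤ (1+u) * Real.log (1+u) := by
  rcases hu.eq_or_lt with h | h
  · subst h; norm_num [P7]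
  · have := G0_nonneg h; unfold G0 at this; linarith

lemma xlog_ge {a x : ℝ} (ha : 0 < a) (hx : 0 ≤ x) : a * P7 ((x - a)/a) ≤ x * Real.log (x/a) := by
  have h : -1 ≤ (x-a)/a := by rw [le_div_iff₀ ha]; linarith
  have := P7_le h
  have e : 1 + (x-a)/a = x/a := by field_simp; ring
  rw [e] at this
  calc _ ≤ a * (x/a * Real.log (x/a)) := by gcongr
    _ = _ := by field_simp

lemma kl_ge {p x : ℝ} (hp : 0 < p) (hp1 : p < 1) (hx : 0 ≤ x) (hx1 : x ≤ 1) :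
    p * P7 ((x-p)/p) + (1-p) * P7 (-(x-p)/(1-p)) ≤ kl p x := by
  have h1 := xlog_ge hp hx
  have h2 := xlog_ge (a := 1-p) (x := 1-x) (by linarith) (by linarith)
  have e : 1 - x - (1-p) = -(x-p) := by ring
  rw [e] at h2
  unfold kl; linarith

/-! ### Logarithm bound -/

lemma log_bound {N : ℝ} (hN : 2 ≤ N) :
    (1/2) * Real.log (N/(N-1)) ≤ 1/(2*N) + 1/(4*N^2) + 1/(6*N^2*(N-1)) := by
  have h1 : 0 < N - 1 := by linarith
  have h2 : 0 < 2*N-1 := by linarith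
  have h := Real.log_div_le_sum_range_add (x := 1/(2*N-1)) (by positivity)
    (by rw [div_lt_one h2]; linarith) 2
  have e : (1 + 1/(2*N-1))/(1 - 1/(2*N-1)) = N/(N-1) := by
    have : (1:ℝ) - 1/(2*N-1) = 2*(N-1)/(2*N-1) := by field_simp; ring
    rw [this]; field_simp; ring
  rw [e] at h
  refine h.trans ?_
  have e2 : 1 - (1/(2*N-1))^2 = 4*N*(N-1)/(2*N-1)^2 := by field_simp; ring
  simp only [Finset.sum_range_succ, Finset.sum_range_zero, Nat.cast_zero, Nat.cast_one]
  rw [e2, ← sub_nonneg]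
  obtain ⟨M, rfl⟩ : ∃ M, N = M + 2 := ⟨N-2, by ring⟩
  have hM : 0 ≤ M := by linarith
  have h3 : (0:ℝ) < 2 * (M+2) - 1 := by linarith
  have h4 : (0:ℝ) < M + 2 - 1 := by linarith
  have key : 1/(2*(M+2)) + 1/(4*(M+2)^2) + 1/(6*(M+2)^2*(M+2-1)) -
      (1/(2*(M+2)-1) + (1/(2*(M+2)-1))^3/3 + (1/(2*(M+2)-1))^5/(4*(M+2)*(M+2-1)/(2*(M+2)-1)^2))
      = (4*M^2+10*M+5)/(12*(M+2)^2*(M+2-1)*(2*(M+2)-1)^3) := by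
    field_simp
    ring
  have h5 : 0 ≤ (4*M^2+10*M+5)/(12*(M+2)^2*(M+2-1)*(2*(M+2)-1)^3) := by positivity
  rw [← key] at h5
  refine h5.trans (le_of_eq ?_)
  norm_num

/-! ### Assembling -/

lemma poly_expand {p N X : ℝ} (hp : 0 < p) (hp1 : p < 1) (hN : 0 < N) :
    p * P7 (X/N/p) + (1-p) * P7 (-(X/N)/(1-p)) =
      (1/2) / (p*(1-p)) / N^2 * X^2
      + -(1/6) * (1-2*p) / (p*(1-p))^2 / N^3 * X^3
      + (1/12) * (1-3*(p*(1-p))) / (p*(1-p))^3 / N^4 * X^4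
      + -(1/20) * ((1-2*p)*(1-2*(p*(1-p)))) / (p*(1-p))^4 / N^5 * X^5
      + (1/30) * (1-5*(p*(1-p))+5*(p*(1-p))^2) / (p*(1-p))^5 / N^6 * X^6
      + -(1/42) * ((1-2*p)*(1-p*(1-p))*(1-3*(p*(1-p)))) / (p*(1-p))^6 / N^7 * X^7 := by
  have hq : 1 - p ≠ 0 := by linarith
  obtain ⟨y, rfl⟩ : ∃ y, X = N * y := ⟨X/N, by field_simp⟩
  unfold P7
  have e : N * y / N = y := by field_simp
  rw [e]
  field_simp
  ring

/-- The lower bound for the entropy increment, as a function of `N = n+1` and `w = ω(p)`. -/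
noncomputable def LB (N w : ℝ) : ℝ :=
  1/(2*N) + (1/4 + w/12)/N^2 + (1/3 + 5/12*w + w^2/12)/N^3
    + (-1 - 133/15*w - 41/5*w^2 - 103/60*w^3)/N^4
    + (8/15 + 268/15*w + 511/30*w^2 - 3/10*w^3 - 13/10*w^4)/N^5
    + (-68/7*w - 194/21*w^2 + 23/14*w^3 + 8/7*w^4 - 1/42*w^5)/N^6

lemma moments_eq {d v w N : ℝ} (hw : 0 ≤ w) (hN : 0 < N) (hv : v = 1/(w+4))
    (hd : d^2 = w/(w+4)) :
      (1/2) / v / N^2 * (N * v)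
      + -(1/6) * d / v^2 / N^3 * (d * (N * v))
      + (1/12) * (1-3*v) / v^3 / N^4 * (N * v - 6 * N * v^2 + 3 * N^2 * v^2)
      + -(1/20) * (d*(1-2*v)) / v^4 / N^5 * (d * (N * v - 12 * N * v^2 + 10 * N^2 * v^2))
      + (1/30) * (1-5*v+5*v^2) / v^5 / N^6 * (N * v - 30 * N * v^2 + 120 * N * v^3
      + 25 * N^2 * v^2 - 130 * N^2 * v^3 + 15 * N^3 * v^3)
      + -(1/42) * (d*(1-v)*(1-3*v)) / v^6 / N^7 * (d * (N * v - 60 * N * v^2 + 360 * N * v^3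
      + 56 * N^2 * v^2 - 462 * N^2 * v^3 + 105 * N^3 * v^3)) = LB N w := by
  have h3 : -(1/6) * d / v^2 / N^3 * (d * (N * v)) = d^2 * (-(1/6) / v^2 / N^3 * (N * v)) := by
    ring
  have h5 : -(1/20) * (d*(1-2*v)) / v^4 / N^5 * (d * (N * v - 12 * N * v^2 + 10 * N^2 * v^2))
    = d^2 * (-(1/20) * (1-2*v) / v^4 / N^5 * (N * v - 12 * N * v^2 + 10 * N^2 * v^2)) := by ring
  have h7 : -(1/42) * (d*(1-v)*(1-3*v)) / v^6 / N^7 * (d * (N * v - 60 * N * v^2 + 360 * N * v^3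
      + 56 * N^2 * v^2 - 462 * N^2 * v^3 + 105 * N^3 * v^3))
    = d^2 * (-(1/42) * ((1-v)*(1-3*v)) / v^6 / N^7 * (N * v - 60 * N * v^2 + 360 * N * v^3
      + 56 * N^2 * v^2 - 462 * N^2 * v^3 + 105 * N^3 * v^3)) := by ring
  rw [h3, h5, h7, hd, hv]
  unfold LB
  have : w + 4 ≠ 0 := by positivity
  field_simp
  ring

lemma LB_ge {N w : ℝ} (hw : 0 ≤ w) (hN : 4.44 * w + 8 ≤ N) :
    1/(2*N) + 1/(4*N^2) + 1/(6*N^2*(N-1)) ≤ LB N w := by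
  have hN0 : 0 < N := by linarith
  have hN1 : 0 < N - 1 := by linarith
  rw [← sub_nonneg]
  have key : LB N w - (1/(2*N) + 1/(4*N^2) + 1/(6*N^2*(N-1))) =
    ((N-1) * (w/12*N^4 + (1/3 + 5/12*w + w^2/12)*N^3
      + (-1 - 133/15*w - 41/5*w^2 - 103/60*w^3)*N^2
      + (8/15 + 268/15*w + 511/30*w^2 - 3/10*w^3 - 13/10*w^4)*N
      + (-68/7*w - 194/21*w^2 + 23/14*w^3 + 8/7*w^4 - 1/42*w^5)) - N^4/6)
      / (N^6*(N-1)) := by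
    unfold LB
    field_simp
    ring
  rw [key]
  apply div_nonneg _ (by positivity)
  obtain ⟨s, hs, rfl⟩ : ∃ s, 0 ≤ s ∧ N = 111/25 * w + 8 + s :=
    ⟨N - (111/25 * w + 8), by norm_num at hN; linarith, by ring⟩
  ring_nf
  positivity

lemma bE_mono {n : ℕ} {p : ℝ} (hp : 0 < p) (hp1 : p < 1) {f g : ℕ → ℝ}
    (h : ∀ k ≤ n, f k ≤ g k) : bE n p f ≤ bE n p g := by
  unfold bE
  apply Finset.sum_le_sum
  intro k hk
  have hk : k ≤ n := by simpa [Nat.lt_succ_iff] using hk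
  exact mul_le_mul_of_nonneg_left (h k hk) (bp_pos hp hp1 hk).le

lemma bE_poly (n : ℕ) (p c2 c3 c4 c5 c6 c7 : ℝ) :
    bE n p (fun k => c2 * ((k:ℝ) - n*p)^2 + c3 * ((k:ℝ) - n*p)^3 + c4 * ((k:ℝ) - n*p)^4
      + c5 * ((k:ℝ) - n*p)^5 + c6 * ((k:ℝ) - n*p)^6 + c7 * ((k:ℝ) - n*p)^7)
    = c2 * cm n p 2 + c3 * cm n p 3 + c4 * cm n p 4 + c5 * cm n p 5 + c6 * cm n p 6
      + c7 * cm n p 7 := by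
  unfold cm bE
  simp only [Finset.mul_sum, ← Finset.sum_add_distrib]
  apply Finset.sum_congr rfl; intros; ring

theorem binomEnt_diff_ge_half_log (p : ℝ) (hp : p ∈ Set.Ioo (0:ℝ) 1) :
    ∀ n : ℕ, ⌈4.44 * ((2 * p - 1) ^ 2 / (p * (1 - p))) + 7⌉₊ ≤ n →
      binomEnt (n + 1) p - binomEnt n p ≥ (1 / 2) * Real.log (((n : ℝ) + 1) / n) := by
  obtain ⟨hp0, hp1⟩ := hp
  intro n hn
  have hq : 0 < 1 - p := by linarith
  have hv : 0 < p * (1-p) := by positivity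
  set w : ℝ := (2 * p - 1) ^ 2 / (p * (1 - p)) with hw
  have hw0 : 0 ≤ w := by positivity
  have hn' : 4.44 * w + 7 ≤ n := Nat.ceil_le.1 hn
  have hw4 : w + 4 = 1/(p*(1-p)) := by rw [hw]; field_simp; ring
  have hv' : p*(1-p) = 1/(w+4) := by rw [hw4]; simp
  have hd : (1-2*p)^2 = w/(w+4) := by rw [hw4, hw]; field_simp; ring
  have hNpos : (0:ℝ) < ((n+1:ℕ):ℝ) := by positivity
  obtain ⟨-, -, m2, m3, m4, m5, m6, m7⟩ := cm_all (n+1) p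
  have hLB : LB ((n+1:ℕ):ℝ) w ≤ binomEnt (n+1) p - binomEnt n p := by
    rw [ent_diff n p hp0 hp1, ← moments_eq hw0 hNpos hv' hd, ← m7, ← m6, ← m5, ← m4, ← m3, ← m2,
      ← bE_poly]
    apply bE_mono hp0 hp1
    intro k hk
    rw [← poly_expand hp0 hp1 hNpos]
    have hk' : (k:ℝ) ≤ (n:ℝ)+1 := by exact_mod_cast hk
    have hn1 : (0:ℝ) < (n:ℝ)+1 := by positivity
    have := kl_ge hp0 hp1 (x := (k:ℝ)/((n:ℝ)+1)) (by positivity) (by rw [div_le_one hn1]; exact hk')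
    have e : ((k:ℝ) - ((n+1:ℕ):ℝ)*p)/((n+1:ℕ):ℝ) = (k:ℝ)/((n:ℝ)+1) - p := by
      push_cast; field_simp
    rw [e]
    exact this
  have h1 := LB_ge (N := ((n+1:ℕ):ℝ)) hw0 (by push_cast; linarith)
  have h2 := log_bound (N := ((n+1:ℕ):ℝ)) (by push_cast; norm_num at hn'; linarith)
  have e : ((n+1:ℕ):ℝ) - 1 = n := by push_cast; ring
  rw [e] at h2 h1
  have e' : ((n+1:ℕ):ℝ) = (n:ℝ)+1 := by push_cast; ring
  rw [← e']
  linarith
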